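/- For all integers s ≥ 1 and i ≥ 2s, one has 𝒟^{s−1}(C(i, s)) = (i!·(i−s−1)!/(i−2s)!)·x_{i+1−s} in R. -/

import Mathlib

open MvPolynomial

noncomputable section

def Dop (g : ℕ) (p : MvPolynomial ℕ ℚ) : MvPolynomial ℕ ℚ :=
  -(g : ℚ) • pderiv 0 p +
    (1/2 : ℚ) •
      ∑ a ∈ Finset.range (p.vars.sup id + 1), ∑ b ∈ Finset.range (p.vars.sup id + 1),
        (((a + b + 2).choose (b + 1) : ℚ)) • (X (a + b) * pderiv a (pderiv b p))

/-- `C(i, s) = ∑ m₁!⋯m_s!·x_{m₁}⋯x_{m_s}`, summed over ordered `s`-tuples of integers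
`m_k ≥ 2` with `m₁ + ⋯ + m_s = i`. -/
def Cpol (i s : ℕ) : MvPolynomial ℕ ℚ :=
  ∑ m ∈ (Finset.Nat.antidiagonalTuple s i).filter (fun m => ∀ k, 2 ≤ m k),
    (∏ k, ((m k).factorial : ℚ)) • ∏ k, X (m k - 1)

/-- `B(i, s)`: as `C(i, s)` but with all parts `m_k ≥ 1`. -/
def Bpol (i s : ℕ) : MvPolynomial ℕ ℚ :=
  ∑ m ∈ (Finset.Nat.antidiagonalTuple s i).filter (fun m => ∀ k, 1 ≤ m k),
    (∏ k, ((m k).factorial : ℚ)) • ∏ k, X (m k - 1)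

theorem pderiv_comm (a b : ℕ) (p : MvPolynomial ℕ ℚ) :
    pderiv a (pderiv b p) = pderiv b (pderiv a p) := by
  have h : ⁅(pderiv a : Derivation ℚ (MvPolynomial ℕ ℚ) (MvPolynomial ℕ ℚ)),
      (pderiv b : Derivation ℚ (MvPolynomial ℕ ℚ) (MvPolynomial ℕ ℚ))⁆ = 0 := by
    ext i : 1
    simp [Derivation.commutator_apply, pderiv_X, Pi.single_apply, apply_ite]
  have := congrArg (fun D => D p) h
  simpa [Derivation.commutator_apply, sub_eq_zero] using this

theorem sum_derivation_apply {ι : Type*} (s : Finset ι)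
    (D : ι → Derivation ℚ (MvPolynomial ℕ ℚ) (MvPolynomial ℕ ℚ)) (p : MvPolynomial ℕ ℚ) :
    (∑ i ∈ s, D i) p = ∑ i ∈ s, D i p := by
  have h := map_sum (Derivation.coeFnAddMonoidHom (R := ℚ) (A := MvPolynomial ℕ ℚ)
    (M := MvPolynomial ℕ ℚ)) D s
  simp only [funext_iff, Finset.sum_apply] at h
  exact h p

/-- The operator `Dop` with the double sum truncated at `N`. -/
def DopTrunc (g N : ℕ) : MvPolynomial ℕ ℚ →ₗ[ℚ] MvPolynomial ℕ ℚ where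
  toFun p := -(g : ℚ) • pderiv 0 p +
    (1/2 : ℚ) • ∑ a ∈ Finset.range N, ∑ b ∈ Finset.range N,
        (((a + b + 2).choose (b + 1) : ℚ)) • (X (a + b) * pderiv a (pderiv b p))
  map_add' p q := by
    simp only [map_add, mul_add, smul_add, Finset.sum_add_distrib]
    abel
  map_smul' c p := by
    simp only [Derivation.map_smul, mul_smul_comm, smul_comm _ c, ← Finset.smul_sum, ← smul_add,
      RingHom.id_apply]

theorem DopTrunc_apply (g N : ℕ) (p : MvPolynomial ℕ ℚ) :
    DopTrunc g N p = -(g : ℚ) • pderiv 0 p +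
      (1/2 : ℚ) • ∑ a ∈ Finset.range N, ∑ b ∈ Finset.range N,
        (((a + b + 2).choose (b + 1) : ℚ)) • (X (a + b) * pderiv a (pderiv b p)) := rfl

theorem pderiv_eq_zero_of_sup_vars_lt {p : MvPolynomial ℕ ℚ} {a : ℕ} (h : p.vars.sup id < a) :
    pderiv a p = 0 :=
  pderiv_eq_zero_of_notMem_vars fun ha => (Finset.le_sup (f := id) ha).not_gt h

theorem Dop_eq_DopTrunc (g : ℕ) {N : ℕ} {p : MvPolynomial ℕ ℚ} (h : p.vars.sup id < N) :
    Dop g p = DopTrunc g N p := by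
  have hsub : Finset.range (p.vars.sup id + 1) ⊆ Finset.range N := by
    simpa using h
  rw [Dop, DopTrunc_apply]
  congr 2
  have hz (a : ℕ) (ha : a ∉ Finset.range (p.vars.sup id + 1)) : pderiv a p = 0 :=
    pderiv_eq_zero_of_sup_vars_lt
      (Nat.succ_le_iff.1 (by simpa only [Finset.mem_range, not_lt] using ha))
  rw [← Finset.sum_subset hsub fun a _ ha => Finset.sum_eq_zero fun b _ => by
    simp [pderiv_comm a b, hz a ha]]
  exact Finset.sum_congr rfl fun a _ => Finset.sum_subset hsub fun b _ hb => by simp [hz b hb]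

/-- `Dop` as a linear map. -/
def DopLin (g : ℕ) : MvPolynomial ℕ ℚ →ₗ[ℚ] MvPolynomial ℕ ℚ where
  toFun := Dop g
  map_add' p q := by
    obtain ⟨N, hN⟩ := exists_gt (max (p.vars.sup id) (max (q.vars.sup id) ((p + q).vars.sup id)))
    simp only [max_lt_iff] at hN
    rw [Dop_eq_DopTrunc g hN.1, Dop_eq_DopTrunc g hN.2.1, Dop_eq_DopTrunc g hN.2.2, map_add]
  map_smul' c p := by
    obtain ⟨N, hN⟩ := exists_gt (max (p.vars.sup id) ((c • p).vars.sup id))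
    simp only [max_lt_iff] at hN
    rw [Dop_eq_DopTrunc g hN.1, Dop_eq_DopTrunc g hN.2, map_smul, RingHom.id_apply]

/-- The derivation `[Dop, X a]`, for `a ≠ 0`. -/
def mergeDer (a : ℕ) : Derivation ℚ (MvPolynomial ℕ ℚ) (MvPolynomial ℕ ℚ) :=
  mkDerivation ℚ fun b => ((a + b + 2).choose (b + 1) : ℚ) • X (a + b)

theorem mergeDer_eq_sum (a : ℕ) {N : ℕ} {p : MvPolynomial ℕ ℚ} (h : p.vars.sup id < N) :
    mergeDer a p = ∑ b ∈ Finset.range N,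
      ((a + b + 2).choose (b + 1) : ℚ) • (X (a + b) * pderiv b p) := by
  have key : mergeDer a p = (∑ b ∈ Finset.range N,
      (((a + b + 2).choose (b + 1) : ℚ) • (X (a + b) : MvPolynomial ℕ ℚ)) •
        (pderiv b : Derivation ℚ (MvPolynomial ℕ ℚ) (MvPolynomial ℕ ℚ))) p := by
    refine derivation_eq_of_forall_mem_vars fun i hi => ?_
    have hiN : i < N := (Finset.le_sup (f := id) hi).trans_lt h
    rw [mergeDer, mkDerivation_X, sum_derivation_apply,
      Finset.sum_eq_single_of_mem i (by simpa using hiN)]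
    · simp
    · intro b _ hb
      simp [pderiv_X_of_ne hb.symm]
  rw [key, sum_derivation_apply]
  simp

theorem Dop_X_mul (g : ℕ) {a : ℕ} (ha : a ≠ 0) (p : MvPolynomial ℕ ℚ) :
    Dop g (X a * p) = X a * Dop g p + mergeDer a p := by
  obtain ⟨N, hN⟩ := exists_gt (max a (max (p.vars.sup id) ((X a * p).vars.sup id)))
  simp only [max_lt_iff] at hN
  rw [Dop_eq_DopTrunc g hN.2.1, Dop_eq_DopTrunc g hN.2.2, mergeDer_eq_sum a hN.2.1,
    DopTrunc_apply, DopTrunc_apply]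
  have h (c b : ℕ) : pderiv c (pderiv b (X a * p)) = X a * pderiv c (pderiv b p) +
      (if b = a then pderiv c p else 0) + (if c = a then pderiv b p else 0) := by
    by_cases hb : b = a <;> by_cases hc : c = a <;>
      simp [pderiv_X, hb, hc]
  have h0 : pderiv 0 (X a * p) = X a * pderiv 0 p := by
    simp [pderiv_X_of_ne ha]
  have h1 : ∑ c ∈ Finset.range N, ∑ b ∈ Finset.range N, ((c + b + 2).choose (b + 1) : ℚ) •
      (X (c + b) * (if b = a then pderiv c p else 0)) = ∑ b ∈ Finset.range N,
      ((a + b + 2).choose (b + 1) : ℚ) • (X (a + b) * pderiv b p) := by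
    refine Finset.sum_congr rfl fun c _ => ?_
    rw [Finset.sum_eq_single_of_mem a (by simpa using hN.1) (fun b _ hb => by simp [hb]),
      if_pos rfl, add_comm c a, Nat.choose_symm_of_eq_add (by ring : a + c + 2 = a + 1 + (c + 1))]
  have h2 : ∑ c ∈ Finset.range N, ∑ b ∈ Finset.range N, ((c + b + 2).choose (b + 1) : ℚ) •
      (X (c + b) * (if c = a then pderiv b p else 0)) = ∑ b ∈ Finset.range N,
      ((a + b + 2).choose (b + 1) : ℚ) • (X (a + b) * pderiv b p) := by
    rw [Finset.sum_eq_single_of_mem a (by simpa using hN.1) (fun b _ hb => by simp [hb])]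
    simp
  simp only [h, h0, mul_add, smul_add, Finset.sum_add_distrib, h1, h2, Finset.mul_sum,
    mul_smul_comm, mul_left_comm (X a)]
  module

/-- The monomial `∏ (a + 1)! X a` over a multiset of indices. -/
def facMonomial (M : Multiset ℕ) : MvPolynomial ℕ ℚ :=
  (M.map fun a => ((a + 1).factorial : ℚ) • (X a : MvPolynomial ℕ ℚ)).prod

theorem facMonomial_cons (a : ℕ) (M : Multiset ℕ) :
    facMonomial (a ::ₘ M) = ((a + 1).factorial : ℚ) • (X a * facMonomial M) := by
  simp [facMonomial]

/-- Linear combinations of the `facMonomial M`, for `M` of cardinality `n` and sum `S` with nonzero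
entries, paired with the sum of their coefficients. -/
def weightSpan (n S : ℕ) : Submodule ℚ (MvPolynomial ℕ ℚ × ℚ) :=
  Submodule.span ℚ
    {x | ∃ M : Multiset ℕ, 0 ∉ M ∧ M.card = n ∧ M.sum = S ∧ x = (facMonomial M, 1)}

theorem facMonomial_mem_weightSpan {M : Multiset ℕ} (h : 0 ∉ M) :
    (facMonomial M, (1 : ℚ)) ∈ weightSpan M.card M.sum :=
  Submodule.subset_span ⟨M, h, rfl, rfl, rfl⟩

theorem map_mem_of_mem_weightSpan {V : Type*} [AddCommGroup V] [Module ℚ V] {n S : ℕ}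
    (L : MvPolynomial ℕ ℚ × ℚ →ₗ[ℚ] V) (W : Submodule ℚ V)
    (hL : ∀ M : Multiset ℕ, 0 ∉ M → M.card = n → M.sum = S → L (facMonomial M, 1) ∈ W)
    {x : MvPolynomial ℕ ℚ × ℚ} (hx : x ∈ weightSpan n S) : L x ∈ W := by
  induction hx using Submodule.span_induction with
  | mem x hx =>
    obtain ⟨M, h0, hM, hS, rfl⟩ := hx
    exact hL M h0 hM hS
  | zero => rw [map_zero]; exact W.zero_mem
  | add x y _ _ hx hy => rw [map_add]; exact W.add_mem hx hy
  | smul c x _ hx => rw [map_smul]; exact W.smul_mem c hx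

theorem X_mul_mem_weightSpan {a n S : ℕ} (ha : a ≠ 0) {p : MvPolynomial ℕ ℚ} {c : ℚ}
    (h : (p, c) ∈ weightSpan n S) :
    (((a + 1).factorial : ℚ) • (X a * p), c) ∈ weightSpan (n + 1) (a + S) := by
  have := map_mem_of_mem_weightSpan
    ((((a + 1).factorial : ℚ) • LinearMap.mulLeft ℚ (X a : MvPolynomial ℕ ℚ)).prodMap
      (LinearMap.id : ℚ →ₗ[ℚ] ℚ)) (weightSpan (n + 1) (a + S)) ?_ h
  · simpa using this
  · rintro M h0 rfl rfl
    have := facMonomial_mem_weightSpan (M := a ::ₘ M) (by simp [h0, ha.symm])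
    simpa [facMonomial_cons] using this

theorem factorial_smul_mergeDer_X (a b : ℕ) :
    ((a + 1).factorial : ℚ) • ((b + 1).factorial : ℚ) • mergeDer a (X b) =
      ((a + b + 2 : ℕ) : ℚ) • ((a + b + 1).factorial : ℚ) • X (a + b) := by
  rw [mergeDer, mkDerivation_X, smul_smul, smul_smul, smul_smul]
  congr 1
  have h := Nat.add_choose_mul_factorial_mul_factorial (a + 1) (b + 1)
  have h' : (a + b + 2).factorial = (a + b + 2) * (a + b + 1).factorial := Nat.factorial_succ _
  rw [show a + 1 + (b + 1) = a + b + 2 by ring, h'] at h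
  norm_cast
  rw [← h]
  ring

theorem mergeDer_mem_weightSpan {a : ℕ} (ha : a ≠ 0) (M : Multiset ℕ) (h : 0 ∉ M) :
    (((a + 1).factorial : ℚ) • mergeDer a (facMonomial M),
      (M.card * (a + 2) + M.sum : ℚ)) ∈ weightSpan M.card (a + M.sum) := by
  induction M using Multiset.induction_on with
  | empty =>
    simp only [facMonomial, Multiset.map_zero, Multiset.prod_zero, Derivation.map_one_eq_zero,
      smul_zero, Multiset.card_zero, Multiset.sum_zero, Nat.cast_zero, zero_mul, add_zero]
    exact (weightSpan 0 a).zero_mem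
  | cons b M ih =>
    simp only [Multiset.mem_cons, not_or] at h
    have h1 := X_mul_mem_weightSpan (Ne.symm h.1) (ih h.2)
    have h2 := (weightSpan _ _).smul_mem ((a + b + 2 : ℕ) : ℚ) (facMonomial_mem_weightSpan
      (M := (a + b) ::ₘ M) (by simp [h.2, ha, eq_comm]))
    rw [Multiset.card_cons, Multiset.sum_cons, add_assoc] at h2
    rw [add_left_comm] at h1
    rw [Multiset.card_cons, Multiset.sum_cons]
    convert add_mem h1 h2 using 1
    rw [Prod.smul_mk, Prod.mk_add_mk, Prod.mk.injEq]
    constructor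
    · have h3 := congrArg (· * facMonomial M) (factorial_smul_mergeDer_X a b)
      simp only [smul_mul_assoc] at h3
      rw [facMonomial_cons, facMonomial_cons, ← h3, Derivation.map_smul, Derivation.leibniz]
      simp only [smul_eq_mul, smul_add, mul_smul_comm, mul_comm (facMonomial M)]
      simp only [smul_smul, mul_comm]
    · push_cast
      simp only [smul_eq_mul]
      ring

theorem Dop_facMonomial_mem_weightSpan (g n : ℕ) (M : Multiset ℕ) (h : 0 ∉ M)
    (hM : M.card = n + 1) :
    (Dop g (facMonomial M), (n * (M.sum + n + 1) : ℚ)) ∈ weightSpan n M.sum := by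
  induction n generalizing M with
  | zero =>
    obtain ⟨a, rfl⟩ := Multiset.card_eq_one.1 hM
    have ha : a ≠ 0 := by simpa [eq_comm] using h
    have : Dop g (facMonomial {a}) = 0 := by
      simp [facMonomial, Dop, pderiv_X, Pi.single_apply, ha.symm, apply_ite]
    rw [this, Nat.cast_zero, zero_mul]
    exact (weightSpan 0 _).zero_mem
  | succ n ih =>
    obtain ⟨a, ha⟩ := Multiset.card_pos_iff_exists_mem.1 (by omega : 0 < M.card)
    obtain ⟨M, rfl⟩ := Multiset.exists_cons_of_mem ha
    simp only [Multiset.mem_cons, not_or] at h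
    have hM' : M.card = n + 1 := by simpa using hM
    have ha := Ne.symm h.1
    have h1 := X_mul_mem_weightSpan ha (ih M h.2 hM')
    have h2 := mergeDer_mem_weightSpan ha M h.2
    rw [hM'] at h2
    rw [Multiset.sum_cons]
    convert add_mem h1 h2 using 1
    rw [Prod.mk_add_mk, Prod.mk.injEq, facMonomial_cons]
    constructor
    · rw [← smul_add, ← Dop_X_mul g ha]
      exact (DopLin g).map_smul _ _
    · push_cast
      ring

theorem Dop_mem_weightSpan (g : ℕ) {n S : ℕ} {p : MvPolynomial ℕ ℚ} {c : ℚ}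
    (h : (p, c) ∈ weightSpan (n + 1) S) :
    (Dop g p, n * (S + n + 1) * c) ∈ weightSpan n S := by
  have := map_mem_of_mem_weightSpan
    ((DopLin g).prodMap (LinearMap.mulLeft ℚ (n * (S + n + 1) : ℚ))) (weightSpan n S) ?_ h
  · simpa [DopLin, mul_assoc] using this
  · rintro M h0 hM rfl
    simpa [DopLin] using Dop_facMonomial_mem_weightSpan g n M h0 hM

theorem eq_of_mem_weightSpan_one {S : ℕ} {p : MvPolynomial ℕ ℚ} {c : ℚ}
    (h : (p, c) ∈ weightSpan 1 S) : p = (c * (S + 1).factorial) • X S := by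
  have := map_mem_of_mem_weightSpan (LinearMap.fst ℚ (MvPolynomial ℕ ℚ) ℚ -
    LinearMap.toSpanSingleton ℚ _ (((S + 1).factorial : ℚ) • X S) ∘ₗ LinearMap.snd ℚ _ _) ⊥ ?_ h
  · simpa [smul_smul, sub_eq_zero] using this
  · rintro M - hM rfl
    obtain ⟨a, rfl⟩ := Multiset.card_eq_one.1 hM
    simp [facMonomial]

theorem iterate_Dop_of_mem_weightSpan (g : ℕ) {n S : ℕ} {p : MvPolynomial ℕ ℚ} {c : ℚ}
    (h : (p, c) ∈ weightSpan (n + 1) S) :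
    (Dop g)^[n] p = (c * n.factorial * (S + n + 1).factorial) • X S := by
  induction n generalizing p c with
  | zero => simpa using eq_of_mem_weightSpan_one h
  | succ n ih =>
    rw [Function.iterate_succ_apply, ih (Dop_mem_weightSpan g h), ← add_assoc S n 1,
      Nat.factorial_succ n, Nat.factorial_succ (S + n + 1)]
    congr 1
    push_cast
    ring

theorem card_antidiagonalTuple_filter_two_le (n k : ℕ) :
    ((Finset.Nat.antidiagonalTuple (n + 1) (k + 2 * (n + 1))).filter (fun m => ∀ j, 2 ≤ m j)).card =
      (k + n).choose n := by
  have h := Finset.card_finsuppAntidiag_nat_eq_choose (s := (Finset.univ : Finset (Fin (n + 1)))) k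
  rw [Finset.card_univ, Fintype.card_fin, show n + 1 + k - 1 = k + n by omega,
    Nat.choose_symm_add] at h
  rw [← h]
  refine Finset.card_nbij' (fun m => Finsupp.equivFunOnFinite.symm fun j => m j - 2)
    (fun f j => f j + 2) ?_ ?_ ?_ ?_
  · intro m hm
    simp only [Finset.coe_filter, Finset.Nat.mem_antidiagonalTuple, Set.mem_ofPred_eq] at hm
    have h2 : ∑ j, m j = ∑ j, (m j - 2) + ∑ _j : Fin (n + 1), 2 := by
      rw [← Finset.sum_add_distrib]
      exact Finset.sum_congr rfl fun j _ => (Nat.sub_add_cancel (hm.2 j)).symm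
    simp at h2 ⊢
    omega
  · intro f hf
    simp only [Finset.mem_coe, Finset.mem_finsuppAntidiag] at hf
    rw [Finset.mem_coe, Finset.mem_filter, Finset.Nat.mem_antidiagonalTuple,
      Finset.sum_add_distrib, hf.1]
    simp [mul_comm]
  · intro m hm
    simp only [Finset.coe_filter, Finset.Nat.mem_antidiagonalTuple, Set.mem_ofPred_eq] at hm
    ext j
    simp [Nat.sub_add_cancel (hm.2 j)]
  · intro f _
    ext j
    simp

theorem Cpol_mem_weightSpan (n k : ℕ) :
    (Cpol (k + 2 * (n + 1)) (n + 1), ((k + n).choose n : ℚ)) ∈ weightSpan (n + 1) (k + n + 1) := by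
  have h : ∑ m ∈ (Finset.Nat.antidiagonalTuple (n + 1) (k + 2 * (n + 1))).filter
      (fun m => ∀ j, 2 ≤ m j), ((∏ j, ((m j).factorial : ℚ)) • ∏ j, X (m j - 1), (1 : ℚ)) ∈
      weightSpan (n + 1) (k + n + 1) := by
    refine Submodule.sum_mem _ fun m hm => ?_
    simp only [Finset.mem_filter, Finset.Nat.mem_antidiagonalTuple] at hm
    have h1 (j) : m j - 1 + 1 = m j := Nat.sub_add_cancel (by have := hm.2 j; omega)
    have h2 : ∑ j, m j = ∑ j, (m j - 1) + ∑ _j : Fin (n + 1), 1 := by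
      rw [← Finset.sum_add_distrib]
      exact Finset.sum_congr rfl fun j _ => (h1 j).symm
    refine Submodule.subset_span
      ⟨Finset.univ.val.map fun j => m j - 1, ?_, by simp, ?_, ?_⟩
    · simp only [Multiset.mem_map, not_exists, not_and]
      intro j _
      have := hm.2 j
      omega
    · change ∑ j, (m j - 1) = _
      simp at h2
      omega
    · simp only [facMonomial, Multiset.map_map, Function.comp_def, h1]
      rw [← Finset.prod_eq_multiset_prod, Finset.prod_smul]
  convert h using 1
  ext1
  · simp [Prod.fst_sum, Cpol]
  · simp [Prod.snd_sum, card_antidiagonalTuple_filter_two_le]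

theorem stmt10 (g : ℕ) (hg : 3 ≤ g) (s i : ℕ) (hs : 1 ≤ s) (hi : 2 * s ≤ i) :
    (Dop g)^[s - 1] (Cpol i s) =
      (((i.factorial : ℚ) * (i - s - 1).factorial) / (i - 2 * s).factorial) • X (i - s) := by
  obtain ⟨n, rfl⟩ : ∃ n, s = n + 1 := ⟨s - 1, by omega⟩
  obtain ⟨k, rfl⟩ : ∃ k, i = k + 2 * (n + 1) := ⟨i - 2 * (n + 1), by omega⟩
  rw [Nat.add_sub_cancel, iterate_Dop_of_mem_weightSpan g (Cpol_mem_weightSpan n k),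
    show k + 2 * (n + 1) - (n + 1) - 1 = k + n by omega,
    show k + 2 * (n + 1) - (n + 1) = k + n + 1 by omega, Nat.add_sub_cancel,
    show k + n + 1 + n + 1 = k + 2 * (n + 1) by ring]
  congr 1
  rw [eq_div_iff (by positivity), ← Nat.add_choose_mul_factorial_mul_factorial k n]
  push_cast
  ring
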